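/- The Gaussian gap function g_G : [0,∞) → ℝ defined by g_G(y) = log(1+y) − ∫_0^∞ log(1+t·y)·e^{−t} dt is monotone nondecreasing on [0,∞). -/

import Mathlib

open MeasureTheory

lemma integrableOn_mul_exp_neg_Ioi :
    IntegrableOn (fun t : ℝ => t * Real.exp (-t)) (Set.Ioi 0) := by
  refine (Real.GammaIntegral_convergent (s := 2) (by norm_num)).congr_fun (fun t _ => ?_)
    measurableSet_Ioi
  norm_num [mul_comm]

lemma integral_mul_exp_neg_Ioi :
    ∫ t in Set.Ioi (0 : ℝ), t * Real.exp (-t) = 1 := by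
  rw [← Real.Gamma_two, Real.Gamma_eq_integral (by norm_num)]
  refine setIntegral_congr_fun measurableSet_Ioi (fun t _ => ?_)
  norm_num [mul_comm]

lemma integrableOn_log_one_add_mul_exp_neg {y : ℝ} (hy : 0 ≤ y) :
    IntegrableOn (fun t : ℝ => Real.log (1 + t * y) * Real.exp (-t)) (Set.Ioi 0) := by
  refine (integrableOn_mul_exp_neg_Ioi.const_mul y).mono'
    (Measurable.aestronglyMeasurable (by fun_prop)) ?_
  refine (ae_restrict_iff' measurableSet_Ioi).2 (.of_forall fun t (ht : 0 < t) => ?_)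
  have hty : 0 ≤ t * y := by positivity
  have hlog : 0 ≤ Real.log (1 + t * y) := Real.log_nonneg (by linarith)
  have hle := Real.log_le_sub_one_of_pos (show 0 < 1 + t * y by linarith)
  rw [Real.norm_of_nonneg (by positivity)]
  calc Real.log (1 + t * y) * Real.exp (-t) ≤ (t * y) * Real.exp (-t) := by
        gcongr; linarith
    _ = y * (t * Real.exp (-t)) := by ring

/-- The concave function `t ↦ log (1 + t b) - log (1 + t a)` lies below its tangent at `1`. -/
lemma log_one_add_mul_sub_le_tangent {a b t : ℝ} (ha : 0 ≤ a) (hab : a ≤ b) (ht : 0 ≤ t) :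
    Real.log (1 + t * b) - Real.log (1 + t * a) ≤
      Real.log (1 + b) - Real.log (1 + a) + (b - a) / ((1 + a) * (1 + b)) * (t - 1) := by
  have hb : 0 ≤ b := ha.trans hab
  have h1 : 0 < 1 + t * b := by positivity
  have h2 : 0 < 1 + t * a := by positivity
  have h3 : 0 < 1 + b := by positivity
  have h4 : 0 < 1 + a := by positivity
  have hlog := Real.log_le_sub_one_of_pos
    (show 0 < ((1 + t * b) * (1 + a)) / ((1 + t * a) * (1 + b)) by positivity)
  rw [Real.log_div (by positivity) (by positivity), Real.log_mul h1.ne' h4.ne',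
    Real.log_mul h2.ne' h3.ne'] at hlog
  have key : (b - a) / ((1 + a) * (1 + b)) * (t - 1) -
      (((1 + t * b) * (1 + a)) / ((1 + t * a) * (1 + b)) - 1) =
      a * (b - a) * (t - 1) ^ 2 / ((1 + a) * (1 + b) * (1 + t * a)) := by
    field_simp
    ring
  have hnn : 0 ≤ a * (b - a) * (t - 1) ^ 2 / ((1 + a) * (1 + b) * (1 + t * a)) := by
    have := sub_nonneg.2 hab
    positivity
  linarith

/-- The Gaussian gap function `g_G(y) = log(1+y) − ∫_0^∞ log(1+t·y)·e^{−t} dt` is monotone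
nondecreasing on `[0,∞)`. -/
theorem stmt_3 :
    MonotoneOn
      (fun y : ℝ =>
        Real.log (1 + y) - ∫ t in Set.Ioi (0 : ℝ), Real.log (1 + t * y) * Real.exp (-t))
      (Set.Ici (0 : ℝ)) := by
  intro a (ha : 0 ≤ a) b (hb : 0 ≤ b) hab
  set c := Real.log (1 + b) - Real.log (1 + a)
  set m := (b - a) / ((1 + a) * (1 + b))
  have hia := integrableOn_log_one_add_mul_exp_neg ha
  have hib := integrableOn_log_one_add_mul_exp_neg hb
  have hexp : IntegrableOn (fun t : ℝ => (c - m) * Real.exp (-t)) (Set.Ioi 0) :=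
    (integrableOn_exp_neg_Ioi 0).const_mul _
  have hmul : IntegrableOn (fun t : ℝ => m * (t * Real.exp (-t))) (Set.Ioi 0) :=
    integrableOn_mul_exp_neg_Ioi.const_mul _
  have hle : (∫ t in Set.Ioi (0 : ℝ), (Real.log (1 + t * b) * Real.exp (-t) -
        Real.log (1 + t * a) * Real.exp (-t))) ≤
      ∫ t in Set.Ioi (0 : ℝ), ((c - m) * Real.exp (-t) + m * (t * Real.exp (-t))) := by
    refine setIntegral_mono_on (hib.sub hia) (hexp.add hmul) measurableSet_Ioi
      fun t (ht : 0 < t) => ?_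
    have := mul_le_mul_of_nonneg_right (log_one_add_mul_sub_le_tangent ha hab ht.le)
      (Real.exp_pos (-t)).le
    linarith
  rw [integral_sub hib hia, integral_add hexp hmul, integral_const_mul, integral_const_mul,
    integral_exp_neg_Ioi_zero, integral_mul_exp_neg_Ioi] at hle
  change Real.log (1 + a) - _ ≤ Real.log (1 + b) - _
  linarith
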